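/- arXiv:2511.07157 — 9 statements merged into one kernel-verified Lean document; each statement's English description precedes it below -/
import Mathlib

section
/- Let G=(V,E) be a finite simple undirected graph with n nodes, let β be a probability distribution on {0,…,n−1}, let u ∈ V and S_0 ⊆ V\{u}, and suppose β(s) > 0 for some s with |S_0| ≤ s ≤ n−1. Suppose the group centrality ν can be written as ν(S) = Σ_{θ∈Θ, θ∼S} g(θ) for a finite set Θ, a function g:Θ→ℝ, and a binary relation ∼ between Θ and subsets of V. Then the semivalue past-aware game-theoretic centrality satisfies φ^β_ν(u|S_0) = C_β · Σ_{s=0}^{n−1} (β(s)/C(n−1,s)) · Σ_{θ∈Θ} g(θ)·(|PC^s_u(θ)| − |NC^s_u(θ)|), where PC^s_u(θ) = {S ⊆ V\{u} : |S|=s, S_0 ⊆ S, θ∼S∪{u}, θ≁S} and NC^s_u(θ) = {S ⊆ V\{u} : |S|=s, S_0 ⊆ S, θ≁S∪{u}, θ∼S}. -/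
open Finset

/-- Theorem (efficient computation of semivalue PAGTC): if the group centrality `ν` can be
written as `ν(S) = Σ_{θ∈Θ, θ∼S} g(θ)` for a finite set `Θ`, a function `g : Θ → ℝ` and a
binary relation `∼` between items and subsets of `V`, then the semivalue past-aware
game-theoretic centrality
`φ^β_ν(u|S_0) = C_β · Σ_{s=|S_0|}^{n−1} (β(s)/C(n−1,s)) · Σ_{S ⊆ V∖{u}, |S|=s, S ⊇ S_0} ν(u|S)`
satisfies
`φ^β_ν(u|S_0) = C_β · Σ_{s=0}^{n−1} (β(s)/C(n−1,s)) · Σ_{θ∈Θ} g(θ)·(|PC^s_u(θ)| − |NC^s_u(θ)|)`,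
with `C_β = (Σ_{s=|S_0|}^{n−1} β(s)·C(n−1−|S_0|, s−|S_0|)/C(n−1,s))⁻¹`,
`PC^s_u(θ) = {S ⊆ V∖{u} : |S|=s, S_0 ⊆ S, θ∼S∪{u}, θ≁S}` and
`NC^s_u(θ) = {S ⊆ V∖{u} : |S|=s, S_0 ⊆ S, θ≁S∪{u}, θ∼S}`. -/
theorem stmt0 {V : Type} [Fintype V] [DecidableEq V] (G : SimpleGraph V)
    (Θ : Type) [Fintype Θ] (g : Θ → ℝ) (rel : Θ → Finset V → Prop)
    [∀ θ S, Decidable (rel θ S)]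
    (ν : Finset V → ℝ)
    (hν : ∀ S : Finset V, ν S = ∑ θ ∈ univ.filter (fun θ => rel θ S), g θ)
    (β : ℕ → ℝ) (hβ0 : ∀ s, 0 ≤ β s)
    (hβ1 : ∑ s ∈ range (Fintype.card V), β s = 1)
    (u : V) (S0 : Finset V) (hu : u ∉ S0)
    (hpos : ∃ s, S0.card ≤ s ∧ s ≤ Fintype.card V - 1 ∧ 0 < β s) :
    (∑ s ∈ Icc S0.card (Fintype.card V - 1),
        β s * ((Fintype.card V - 1 - S0.card).choose (s - S0.card) : ℝ) /
          ((Fintype.card V - 1).choose s : ℝ))⁻¹ *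
      ∑ s ∈ Icc S0.card (Fintype.card V - 1),
        β s / ((Fintype.card V - 1).choose s : ℝ) *
          ∑ S ∈ ((univ.erase u).powersetCard s).filter (fun S => S0 ⊆ S),
            (ν (insert u S) - ν S)
    =
    (∑ s ∈ Icc S0.card (Fintype.card V - 1),
        β s * ((Fintype.card V - 1 - S0.card).choose (s - S0.card) : ℝ) /
          ((Fintype.card V - 1).choose s : ℝ))⁻¹ *
      ∑ s ∈ range (Fintype.card V),
        β s / ((Fintype.card V - 1).choose s : ℝ) *
          ∑ θ : Θ, g θ *
            (((((univ.erase u).powersetCard s).filter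
                (fun S => S0 ⊆ S ∧ rel θ (insert u S) ∧ ¬ rel θ S)).card : ℝ) -
             ((((univ.erase u).powersetCard s).filter
                (fun S => S0 ⊆ S ∧ ¬ rel θ (insert u S) ∧ rel θ S)).card : ℝ)) := by
  have hn : 0 < Fintype.card V := Fintype.card_pos_iff.mpr ⟨u⟩
  congr 1
  have key : ∀ s, ∑ S ∈ ((univ.erase u).powersetCard s).filter (fun S => S0 ⊆ S),
            (ν (insert u S) - ν S) = ∑ θ : Θ, g θ *
            (((((univ.erase u).powersetCard s).filter
                (fun S => S0 ⊆ S ∧ rel θ (insert u S) ∧ ¬ rel θ S)).card : ℝ) -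
             ((((univ.erase u).powersetCard s).filter
                (fun S => S0 ⊆ S ∧ ¬ rel θ (insert u S) ∧ rel θ S)).card : ℝ)) := by
    intro s
    simp only [hν, sum_filter, card_filter, Nat.cast_sum, ← sum_sub_distrib, mul_sum]
    rw [sum_comm]
    refine sum_congr rfl fun S _ => ?_
    by_cases h0 : S0 ⊆ S
    · rw [if_pos h0]
      refine sum_congr rfl fun θ _ => ?_
      by_cases h1 : rel θ (insert u S) <;> by_cases h2 : rel θ S <;> simp [h0, h1, h2]
    · simp [h0]
  simp only [← key]
  refine sum_subset ?_ ?_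
  · intro s hs
    simp only [mem_Icc, mem_range] at *
    omega
  · intro s hs hs'
    have hlt : s < S0.card := by
      simp only [mem_Icc, mem_range] at *
      omega
    rw [filter_eq_empty_iff.mpr, sum_empty, mul_zero]
    intro S hS hsub
    have h1 := card_le_card hsub
    have h2 := (mem_powersetCard.mp hS).2
    omega
end

section
/- Let n ≥ 1 and let k ≤ n−1 be nonnegative integers. Then Σ_{s=k}^{n−1} (1/n)·C(n−1−k, s−k)/C(n−1,s) = 1/(k+1). Consequently, for the uniform distribution β(s) = 1/n on {0,…,n−1} (the Shapley case) and any set S_0 of size k contained in V\{u}, the normalization constant of the past-aware game-theoretic centrality is C_β = |S_0| + 1. -/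
/-- For `n ≥ 1` and `k ≤ n−1`:
`Σ_{s=k}^{n−1} (1/n)·C(n−1−k, s−k)/C(n−1,s) = 1/(k+1)`.
Consequently, for the uniform distribution `β(s) = 1/n` on `{0,…,n−1}` (the Shapley case)
and any set `S_0` of size `k` contained in `V∖{u}`, the normalization constant of the
past-aware game-theoretic centrality,
`C_β = (Σ_{s=|S_0|}^{n−1} β(s)·C(n−1−|S_0|, s−|S_0|)/C(n−1,s))⁻¹`, equals `|S_0| + 1`. -/
theorem stmt2 (n k : ℕ) (hn : 1 ≤ n) (hk : k ≤ n - 1) :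
    (∑ s ∈ Finset.Icc k (n - 1),
        1 / (n : ℝ) * ((n - 1 - k).choose (s - k) : ℝ) / ((n - 1).choose s : ℝ))
      = 1 / ((k : ℝ) + 1)
    ∧ ∀ (V : Type) (instF : Fintype V), @Fintype.card V instF = n →
        ∀ (u : V) (S0 : Finset V), u ∉ S0 → S0.card = k →
          (∑ s ∈ Finset.Icc S0.card (n - 1),
              1 / (n : ℝ) * ((n - 1 - S0.card).choose (s - S0.card) : ℝ) /
                ((n - 1).choose s : ℝ))⁻¹
            = (S0.card : ℝ) + 1 := by
  have key : (∑ s ∈ Finset.Icc k (n - 1),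
        1 / (n : ℝ) * ((n - 1 - k).choose (s - k) : ℝ) / ((n - 1).choose s : ℝ))
      = 1 / ((k : ℝ) + 1) := by
    obtain ⟨m, rfl⟩ : ∃ m, n = m + 1 := ⟨n - 1, by omega⟩
    simp only [Nat.add_sub_cancel] at hk ⊢
    have hmk : ((m.choose k : ℕ) : ℝ) ≠ 0 := by
      exact_mod_cast (Nat.choose_pos hk).ne'
    have hm : ((m + 1 : ℕ) : ℝ) ≠ 0 := by positivity
    have hterm : ∀ s ∈ Finset.Icc k m,
        1 / ((m + 1 : ℕ) : ℝ) * ((m - k).choose (s - k) : ℝ) / (m.choose s : ℝ)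
          = (s.choose k : ℝ) * (1 / (((m + 1 : ℕ) : ℝ) * (m.choose k : ℝ))) := by
      intro s hs
      rw [Finset.mem_Icc] at hs
      have hms : ((m.choose s : ℕ) : ℝ) ≠ 0 := by
        exact_mod_cast (Nat.choose_pos hs.2).ne'
      have h : (m.choose s : ℝ) * (s.choose k : ℝ)
          = (m.choose k : ℝ) * ((m - k).choose (s - k) : ℝ) := by
        exact_mod_cast Nat.choose_mul hs.1
      field_simp
      linarith
    rw [Finset.sum_congr rfl hterm, ← Finset.sum_mul]
    have h1 : (∑ s ∈ Finset.Icc k m, (s.choose k : ℝ)) = ((m + 1).choose (k + 1) : ℝ) := by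
      exact_mod_cast Nat.sum_Icc_choose m k
    have h2 : ((m + 1 : ℕ) : ℝ) * (m.choose k : ℝ)
        = ((m + 1).choose (k + 1) : ℝ) * ((k : ℝ) + 1) := by
      exact_mod_cast Nat.add_one_mul_choose_eq m k
    have h3 : (((m + 1).choose (k + 1) : ℕ) : ℝ) ≠ 0 := by
      exact_mod_cast (Nat.choose_pos (by omega : k + 1 ≤ m + 1)).ne'
    have h4 : (k : ℝ) + 1 ≠ 0 := by positivity
    rw [h1, h2]
    field_simp
  refine ⟨key, ?_⟩
  intro V _ _ u S0 _ hS
  rw [hS, key]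
  simp
end

section
/- Let G=(V,E) be a finite simple undirected graph with n nodes, K ≥ 1 an integer, u ∈ V, and S_0 ⊆ V\{u}. For every v ∈ V let s_v = |N(v)\S_0| and r_v = K − 1 − |N(v) ∩ S_0|. Then the Shapley past-aware game-theoretic centrality associated with the one-round influence ν_K satisfies φ^{Sh}_{ν_K}(u|S_0) = (|S_0|+1)·[ C_1(u) + Σ_{v ∈ N(u), v ∉ S_0, deg(v) ≥ K} C_2(v) ], where C_1(u) = [ C(|S_0|+1+min{s_u,r_u}, |S_0|+1) / C(|S_0|+s_u, |S_0|) ] / (|S_0|+s_u+1) and C_2(v) = [ C(s_v−1, r_v) / C(|S_0|+s_v, |S_0|+r_v) ] / (|S_0|+s_v+1), with the convention that C(x,y) = 0 if x or y is negative. -/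
open Finset

/-- Binomial coefficient on integers, with the convention that it vanishes
when either argument is negative. -/
def chooseZ (a b : ℤ) : ℕ := if a < 0 ∨ b < 0 then 0 else a.toNat.choose b.toNat

/-- The one-round influence group centrality of `K`-complex contagion:
`ν_K(S) = |S| + |{v ∈ V∖S : |N(v) ∩ S| ≥ K}|`. -/
def nuK {V : Type} [Fintype V] [DecidableEq V] (G : SimpleGraph V) [DecidableRel G.Adj]
    (K : ℕ) (S : Finset V) : ℝ :=
  (S.card : ℝ) +
    ((univ.filter (fun v => v ∉ S ∧ K ≤ (G.neighborFinset v ∩ S).card)).card : ℝ)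

/-- The semivalue past-aware game-theoretic centrality
`φ^β_ν(u|S_0) = C_β · Σ_{s=|S_0|}^{n−1} (β(s)/C(n−1,s)) · Σ_{S ⊆ V∖{u}, |S|=s, S ⊇ S_0} ν(u|S)`,
with `C_β = (Σ_{s=|S_0|}^{n−1} β(s)·C(n−1−|S_0|, s−|S_0|)/C(n−1,s))⁻¹`.
The Shapley case corresponds to the uniform distribution `β(s) = 1/n`. -/
noncomputable def pagtc {V : Type} [Fintype V] [DecidableEq V]
    (ν : Finset V → ℝ) (β : ℕ → ℝ) (u : V) (S0 : Finset V) : ℝ :=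
  (∑ s ∈ Icc S0.card (Fintype.card V - 1),
      β s * ((Fintype.card V - 1 - S0.card).choose (s - S0.card) : ℝ) /
        ((Fintype.card V - 1).choose s : ℝ))⁻¹ *
  ∑ s ∈ Icc S0.card (Fintype.card V - 1),
    β s / ((Fintype.card V - 1).choose s : ℝ) *
      ∑ S ∈ ((univ.erase u).powersetCard s).filter (fun S => S0 ⊆ S),
        (ν (insert u S) - ν S)

open Nat in
/-- Beta weight `a! b! / (a+b+1)!`. -/
noncomputable def bw (a b : ℕ) : ℝ := (a ! : ℝ) * (b ! : ℝ) / ((a + b + 1) ! : ℝ)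

lemma bw_rec (a b : ℕ) : bw a (b+1) + bw (a+1) b = bw a b := by
  unfold bw
  have h1 : a + (b+1) + 1 = (a + b + 1) + 1 := by ring
  have h2 : a + 1 + b + 1 = (a + b + 1) + 1 := by ring
  rw [h1, h2, Nat.factorial_succ (a+b+1), Nat.factorial_succ a, Nat.factorial_succ b]
  have := Nat.factorial_ne_zero (a+b+1)
  push_cast
  field_simp
  ring

lemma bw_choose (a b : ℕ) : bw a b = 1 / ((a + b).choose a : ℝ) / ((a:ℝ) + b + 1) := by
  unfold bw
  have h := Nat.choose_mul_factorial_mul_factorial (Nat.le_add_right a b)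
  rw [Nat.add_sub_cancel_left] at h
  rw [Nat.factorial_succ, ← h]
  have h1 := Nat.factorial_ne_zero a
  have h2 := Nat.factorial_ne_zero b
  have h3 := (Nat.choose_pos (Nat.le_add_right a b)).ne'
  have h4 : (a:ℝ) + b + 1 ≠ 0 := by positivity
  push_cast
  field_simp

lemma bw_marg {V : Type} [DecidableEq V] (A D : Finset V) (hAD : Disjoint A D)
    (f : Finset V → ℝ) (a b : ℕ) :
    ∑ T ∈ (A ∪ D).powerset, bw (a + T.card) (b + ((A ∪ D).card - T.card)) * f (T ∩ A)
      = ∑ T ∈ A.powerset, bw (a + T.card) (b + (A.card - T.card)) * f T := by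
  induction D using Finset.induction_on with
  | empty =>
    rw [Finset.union_empty]
    refine Finset.sum_congr rfl fun T hT => ?_
    rw [Finset.inter_eq_left.2 (Finset.mem_powerset.1 hT)]
  | insert x D hx ih =>
    rw [Finset.disjoint_insert_right] at hAD
    have hxA : x ∉ A ∪ D := by simp [hx, hAD.1]
    rw [← ih hAD.2, Finset.union_insert, Finset.sum_powerset_insert hxA, ← Finset.sum_add_distrib]
    refine Finset.sum_congr rfl fun T hT => ?_
    rw [Finset.mem_powerset] at hT
    have hxT : x ∉ T := fun h => hxA (hT h)
    have hc := Finset.card_le_card hT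
    rw [Finset.insert_inter_of_notMem hAD.1, Finset.card_insert_of_notMem hxA,
      Finset.card_insert_of_notMem hxT, ← bw_rec (a + T.card) (b + ((A ∪ D).card - T.card)), add_mul]
    rw [show b + ((A ∪ D).card + 1 - T.card) = b + ((A ∪ D).card - T.card) + 1 by omega,
      show a + (T.card + 1) = a + T.card + 1 by omega,
      show (A ∪ D).card + 1 - (T.card + 1) = (A ∪ D).card - T.card by omega]

lemma bw_marg' {V : Type} [DecidableEq V] (A M : Finset V) (hAM : A ⊆ M)
    (f : Finset V → ℝ) (a b : ℕ) :
    ∑ T ∈ M.powerset, bw (a + T.card) (b + (M.card - T.card)) * f (T ∩ A)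
      = ∑ T ∈ A.powerset, bw (a + T.card) (b + (A.card - T.card)) * f T := by
  have := bw_marg A (M \ A) Finset.disjoint_sdiff f a b
  rwa [Finset.union_sdiff_of_subset hAM] at this

lemma sum_reindex {V : Type} [Fintype V] [DecidableEq V] (u : V) (S0 : Finset V) (hu : u ∉ S0)
    (c : ℕ → ℝ) (g : Finset V → ℝ) :
    ∑ s ∈ Finset.Icc S0.card (Fintype.card V - 1), c s *
      ∑ S ∈ ((Finset.univ.erase u).powersetCard s).filter (fun S => S0 ⊆ S), g S
    = ∑ T ∈ (Finset.univ.erase u \ S0).powerset, c (S0.card + T.card) * g (S0 ∪ T) := by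
  simp_rw [Finset.mul_sum]
  rw [Finset.sum_sigma']
  refine Finset.sum_bij' (fun p _ => p.2 \ S0) (fun T _ => ⟨S0.card + T.card, S0 ∪ T⟩) ?_ ?_ ?_ ?_ ?_
  · rintro ⟨s, S⟩ h
    simp only [Finset.mem_sigma, Finset.mem_filter, Finset.mem_powersetCard, Finset.mem_powerset] at h ⊢
    exact Finset.sdiff_subset_sdiff h.2.1.1 subset_rfl
  · intro T h
    rw [Finset.mem_powerset] at h
    have hd : Disjoint S0 T := Finset.disjoint_of_subset_right h Finset.disjoint_sdiff
    have hs : S0 ∪ T ⊆ Finset.univ.erase u := by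
      apply Finset.union_subset
      · intro x hx
        simp; rintro rfl; exact hu hx
      · exact h.trans Finset.sdiff_subset
    have hc := Finset.card_le_card hs
    rw [Finset.card_union_of_disjoint hd, Finset.card_erase_of_mem (Finset.mem_univ _),
      Finset.card_univ] at hc
    simp only [Finset.mem_sigma, Finset.mem_filter, Finset.mem_powersetCard, Finset.mem_Icc]
    exact ⟨⟨by omega, hc⟩, ⟨hs, Finset.card_union_of_disjoint hd⟩, Finset.subset_union_left⟩
  · rintro ⟨s, S⟩ h
    simp only [Finset.mem_sigma, Finset.mem_filter, Finset.mem_powersetCard, Finset.mem_Icc] at h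
    obtain ⟨h1, ⟨h2, rfl⟩, h3⟩ := h
    have := Finset.card_sdiff_add_card_eq_card h3
    have e1 : S0.card + (S \ S0).card = S.card := by omega
    have e2 := Finset.union_sdiff_of_subset h3
    simp only [e1, e2]
  · intro T h
    rw [Finset.mem_powerset] at h
    have hd : Disjoint S0 T := Finset.disjoint_of_subset_right h Finset.disjoint_sdiff
    simp only [Finset.union_sdiff_cancel_left hd]
  · rintro ⟨s, S⟩ h
    simp only [Finset.mem_sigma, Finset.mem_filter, Finset.mem_powersetCard, Finset.mem_Icc] at h
    obtain ⟨h1, ⟨h2, rfl⟩, h3⟩ := h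
    have := Finset.card_sdiff_add_card_eq_card h3
    have e1 : S0.card + (S \ S0).card = S.card := by omega
    have e2 := Finset.union_sdiff_of_subset h3
    simp only [e1, e2]

lemma nuK_marg {V : Type} [Fintype V] [DecidableEq V] (G : SimpleGraph V) [DecidableRel G.Adj]
    (K : ℕ) (S : Finset V) (u : V) (hu : u ∉ S) :
    nuK G K (insert u S) - nuK G K S =
      (if (G.neighborFinset u ∩ S).card < K then 1 else 0) +
      ∑ v ∈ G.neighborFinset u,
        if v ∉ S ∧ (G.neighborFinset v ∩ S).card + 1 = K then (1:ℝ) else 0 := by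
  unfold nuK
  simp only [Finset.card_filter, Finset.card_insert_of_notMem hu]
  push_cast
  have key : ∀ v, (if v ∉ insert u S ∧ K ≤ (G.neighborFinset v ∩ insert u S).card then (1:ℝ) else 0)
      = (if v ∉ S ∧ K ≤ (G.neighborFinset v ∩ S).card then (1:ℝ) else 0)
      - (if v = u then (if K ≤ (G.neighborFinset u ∩ S).card then (1:ℝ) else 0) else 0)
      + (if v ∈ G.neighborFinset u then
          (if v ∉ S ∧ (G.neighborFinset v ∩ S).card + 1 = K then (1:ℝ) else 0) else 0) := by
    intro v
    by_cases hv : v = u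
    · subst hv
      simp [hu]
    · by_cases ha : G.Adj u v
      · have hm : u ∈ G.neighborFinset v := by simpa using ha.symm
        have hc : (G.neighborFinset v ∩ insert u S).card = (G.neighborFinset v ∩ S).card + 1 := by
          rw [Finset.inter_insert_of_mem hm, Finset.card_insert_of_notMem (by simp [hu])]
        have hm2 : v ∈ G.neighborFinset u := by simpa using ha
        rw [hc, if_neg hv, if_pos hm2]
        simp only [Finset.mem_insert, hv, false_or]
        by_cases hS : v ∈ S
        · simp [hS]
        · simp only [hS, not_false_eq_true, true_and]
          split_ifs <;> first | omega | norm_num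
      · have hm : u ∉ G.neighborFinset v := by simpa using fun h => ha (G.adj_symm h)
        have hm2 : v ∉ G.neighborFinset u := by simpa using ha
        rw [Finset.inter_insert_of_notMem hm, if_neg hv, if_neg hm2]
        simp [hv]
  simp_rw [key]
  rw [Finset.sum_add_distrib, Finset.sum_sub_distrib, Finset.sum_ite_eq' Finset.univ u,
    Finset.sum_ite_mem, Finset.univ_inter, if_pos (Finset.mem_univ u)]
  have : (if (G.neighborFinset u ∩ S).card < K then (1:ℝ) else 0) =
     1 - (if K ≤ (G.neighborFinset u ∩ S).card then (1:ℝ) else 0) := by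
    split_ifs <;> first | omega | norm_num
  rw [this]
  ring

lemma choose_ratio (k s j : ℕ) (h : j ≤ s) :
    (s.choose j : ℝ) * bw (k + j) (s - j) =
      ((k + j).choose k : ℝ) / ((k + s).choose k : ℝ) / ((k:ℝ) + s + 1) := by
  obtain ⟨i, rfl⟩ := Nat.exists_eq_add_of_le h
  have e : k + j + i = k + (j + i) := by ring
  have c1 := Nat.choose_mul_factorial_mul_factorial (Nat.le_add_right j i)
  have c2 := Nat.choose_mul_factorial_mul_factorial (Nat.le_add_right k j)
  have c3 := Nat.choose_mul_factorial_mul_factorial (Nat.le_add_right k (j + i))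
  have p3 := (Nat.choose_pos (Nat.le_add_right k (j + i))).ne'
  rw [Nat.add_sub_cancel_left] at c1 c2 c3 ⊢
  unfold bw
  rw [e, Nat.factorial_succ (k + (j+i)), ← c3, ← c2, ← c1]
  have p1 := (Nat.choose_pos (Nat.le_add_right j i)).ne'
  have h1 := Nat.factorial_ne_zero j
  have h2 := Nat.factorial_ne_zero i
  have h3 := Nat.factorial_ne_zero k
  have h7 : (k:ℝ) + (j + i) + 1 ≠ 0 := by positivity
  push_cast
  field_simp

lemma sum_C1 (k s : ℕ) (r : ℤ) :
    ∑ j ∈ Finset.range (s+1), (s.choose j : ℝ) * (bw (k + j) (s - j) * (if (j:ℤ) ≤ r then 1 else 0))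
      = (chooseZ ((k:ℤ) + 1 + min (s:ℤ) r) ((k:ℤ) + 1) : ℝ) / ((k + s).choose k : ℝ)
        / ((k:ℝ) + s + 1) := by
  rcases lt_or_ge r 0 with hr | hr
  · have h0 : chooseZ ((k:ℤ) + 1 + min (s:ℤ) r) ((k:ℤ) + 1) = 0 := by
      unfold chooseZ
      split_ifs with h
      · rfl
      · apply Nat.choose_eq_zero_of_lt
        omega
    rw [h0]
    simp only [Nat.cast_zero, zero_div]
    refine Finset.sum_eq_zero fun j _ => ?_
    rw [if_neg (by omega)]; ring
  · lift r to ℕ using hr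
    have h0 : chooseZ ((k:ℤ) + 1 + min (s:ℤ) (r:ℤ)) ((k:ℤ) + 1) = (k + 1 + min s r).choose (k+1) := by
      unfold chooseZ
      rw [if_neg (by omega)]
      congr 1
      omega
    have h1 : ∑ j ∈ Finset.range (min s r + 1), (k + j).choose k = (k + 1 + min s r).choose (k+1) := by
      have := Nat.sum_range_add_choose (min s r) k
      rw [show k + 1 + min s r = min s r + k + 1 by ring, ← this]
      exact Finset.sum_congr rfl fun j _ => by rw [add_comm]
    rw [h0, ← h1]
    push_cast
    rw [Finset.sum_div, Finset.sum_div]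
    symm
    have hsub : Finset.range (min s r + 1) ⊆ Finset.range (s+1) := by
      intro x; simp only [Finset.mem_range]; omega
    rw [← Finset.sum_subset hsub]
    · refine Finset.sum_congr rfl fun j hj => ?_
      rw [Finset.mem_range] at hj
      rw [if_pos (by omega), mul_one, choose_ratio _ _ _ (by omega)]
    · intro j hj hj2
      rw [Finset.mem_range] at hj hj2
      rw [if_neg (by omega)]; ring

lemma sum_C2 (k s : ℕ) (hs : 1 ≤ s) (r : ℤ) :
    ∑ j ∈ Finset.range (s - 1 + 1), ((s-1).choose j : ℝ) *
        (bw (k + j) (1 + (s - 1 - j)) * (if (j:ℤ) = r then 1 else 0))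
      = (chooseZ ((s:ℤ) - 1) r : ℝ) / (chooseZ ((k:ℤ) + s) ((k:ℤ) + r) : ℝ) / ((k:ℝ) + s + 1) := by
  by_cases hr : 0 ≤ r ∧ r < s
  · obtain ⟨hr, hr2⟩ := hr
    lift r to ℕ using hr
    have h1 : chooseZ ((s:ℤ) - 1) (r:ℤ) = (s-1).choose r := by
      unfold chooseZ
      rw [if_neg (by omega)]
      congr 1; omega
    have h2 : chooseZ ((k:ℤ) + s) ((k:ℤ) + (r:ℤ)) = (k + s).choose (k + r) := by
      unfold chooseZ
      rw [if_neg (by omega)]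
      congr 1
    rw [Finset.sum_eq_single r, if_pos rfl, h1, h2, bw_choose]
    · have e : k + r + (1 + (s - 1 - r)) = k + s := by omega
      have e2 : ((k + r : ℕ):ℝ) + ((1 + (s - 1 - r) : ℕ):ℝ) = k + s := by
        rw [← Nat.cast_add, e, Nat.cast_add]
      rw [e, e2]; ring
    · intro j _ hj
      rw [if_neg (by omega)]; ring
    · intro h; simp only [Finset.mem_range] at h; omega
  · have h0 : chooseZ ((s:ℤ) - 1) r = 0 := by
      unfold chooseZ
      split_ifs with h
      · rfl
      · apply Nat.choose_eq_zero_of_lt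
        omega
    rw [h0]
    simp only [Nat.cast_zero, zero_div]
    refine Finset.sum_eq_zero fun j hj => ?_
    rw [Finset.mem_range] at hj
    rw [if_neg (by omega)]; ring

/-- Theorem (closed form for the Shapley PAGTC associated with the one-round influence
`ν_K`): with `s_v = |N(v)∖S_0|` and `r_v = K − 1 − |N(v) ∩ S_0|`,
`φ^Sh_{ν_K}(u|S_0) = (|S_0|+1)·[C_1(u) + Σ_{v ∈ N(u), v ∉ S_0, deg(v) ≥ K} C_2(v)]`, where
`C_1(u) = [C(|S_0|+1+min{s_u,r_u}, |S_0|+1)/C(|S_0|+s_u, |S_0|)]/(|S_0|+s_u+1)` and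
`C_2(v) = [C(s_v−1, r_v)/C(|S_0|+s_v, |S_0|+r_v)]/(|S_0|+s_v+1)`,
with the convention that `C(x,y) = 0` if `x` or `y` is negative. -/
theorem stmt5 {V : Type} [Fintype V] [DecidableEq V] (G : SimpleGraph V)
    [DecidableRel G.Adj] (K : ℕ) (hK : 1 ≤ K) (u : V) (S0 : Finset V) (hu : u ∉ S0)
    (sv : V → ℕ) (hsv : ∀ v, sv v = (G.neighborFinset v \ S0).card)
    (rv : V → ℤ) (hrv : ∀ v, rv v = (K : ℤ) - 1 - ((G.neighborFinset v ∩ S0).card : ℤ)) :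
    pagtc (nuK G K) (fun _ => 1 / (Fintype.card V : ℝ)) u S0
      = ((S0.card : ℝ) + 1) *
          ((chooseZ ((S0.card : ℤ) + 1 + min ((sv u : ℤ)) (rv u)) ((S0.card : ℤ) + 1) : ℝ) /
              ((S0.card + sv u).choose S0.card : ℝ) / ((S0.card : ℝ) + (sv u : ℝ) + 1)
            + ∑ v ∈ (G.neighborFinset u).filter (fun v => v ∉ S0 ∧ K ≤ G.degree v),
                (chooseZ ((sv v : ℤ) - 1) (rv v) : ℝ) /
                  (chooseZ ((S0.card : ℤ) + (sv v : ℤ)) ((S0.card : ℤ) + rv v) : ℝ) /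
                  ((S0.card : ℝ) + (sv v : ℝ) + 1)) := by
  set k := S0.card with hk
  set n := Fintype.card V with hn
  set M := Finset.univ.erase u \ S0 with hM
  have hsub0 : S0 ⊆ Finset.univ.erase u := by
    intro x hx
    simp; rintro rfl; exact hu hx
  have hMc : M.card + k = n - 1 := by
    rw [hM, hk, Finset.card_sdiff_add_card_eq_card hsub0,
      Finset.card_erase_of_mem (Finset.mem_univ _), Finset.card_univ]
  have hn1 : 1 ≤ n := Fintype.card_pos_iff.2 ⟨u⟩
  have hw : ∀ t, t ≤ M.card → 1 / (n:ℝ) / ((n-1).choose (k + t) : ℝ) = bw (k + t) (M.card - t) := by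
    intro t ht
    rw [bw_choose]
    have e : k + t + (M.card - t) = n - 1 := by omega
    have e2 : ((k + t : ℕ):ℝ) + ((M.card - t : ℕ):ℝ) + 1 = n := by
      rw [← Nat.cast_add, e]; exact_mod_cast Nat.sub_add_cancel hn1
    rw [e, e2]; ring
  have hCb : ∑ s ∈ Icc k (n - 1), 1 / (n:ℝ) * ((n - 1 - k).choose (s - k) : ℝ) /
      ((n - 1).choose s : ℝ) = 1 / ((k:ℝ) + 1) := by
    have h1 := bw_marg' ∅ M (Finset.empty_subset _) (fun _ => 1) k 0
    rw [Finset.powerset_empty, Finset.sum_singleton] at h1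
    simp only [mul_one, zero_add] at h1
    rw [Finset.sum_powerset_apply_card (fun t => bw (k + t) (M.card - t))] at h1
    have h2 : bw (k + (∅ : Finset V).card) ((∅ : Finset V).card - (∅ : Finset V).card)
      = 1 / ((k:ℝ) + 1) := by
      rw [bw_choose]; simp
    rw [← h2, ← h1]
    rw [← Finset.Ico_add_one_right_eq_Icc, Finset.sum_Ico_eq_sum_range]
    rw [show n - 1 + 1 - k = M.card + 1 by omega]
    refine Finset.sum_congr rfl fun t ht => ?_
    rw [Finset.mem_range] at ht
    rw [← hw t (by omega), nsmul_eq_mul, Nat.add_sub_cancel_left, show n - 1 - k = M.card by omega]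
    ring
  have hN : ∀ v (T : Finset V), T ⊆ M → (G.neighborFinset v ∩ (S0 ∪ T)).card =
      (G.neighborFinset v ∩ S0).card + (G.neighborFinset v ∩ T).card := by
    intro v T hT
    rw [Finset.inter_union_distrib_left, Finset.card_union_of_disjoint]
    exact Finset.disjoint_of_subset_left Finset.inter_subset_right
      (Finset.disjoint_of_subset_right (Finset.inter_subset_right.trans hT) Finset.disjoint_sdiff)
  unfold pagtc
  rw [sum_reindex u S0 hu (fun s => 1 / (n:ℝ) / ((n-1).choose s : ℝ))
    (fun S => nuK G K (insert u S) - nuK G K S), hCb, one_div, inv_inv]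
  congr 1
  have hstep : ∀ T ∈ M.powerset, 1 / (n:ℝ) / ((n-1).choose (k + T.card) : ℝ) *
      (nuK G K (insert u (S0 ∪ T)) - nuK G K (S0 ∪ T)) =
      bw (k + T.card) (0 + (M.card - T.card)) *
        (if (((T ∩ (G.neighborFinset u \ S0)).card : ℕ) : ℤ) ≤ rv u then 1 else 0) +
      ∑ v ∈ (G.neighborFinset u).filter (fun v => v ∉ S0),
        bw (k + T.card) (0 + (M.card - T.card)) *
        (if v ∉ T ∩ (insert v ((G.neighborFinset v \ S0).erase u)) ∧
          (((T ∩ (insert v ((G.neighborFinset v \ S0).erase u))).card : ℕ) : ℤ) = rv v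
          then 1 else 0) := by
    intro T hT
    rw [Finset.mem_powerset] at hT
    have huT : u ∉ T := fun h => by have := hT h; simp [hM] at this
    have hdT : ∀ x ∈ T, x ∉ S0 := fun x hx h => by have := hT hx; simp [hM, h] at this
    rw [hw _ (Finset.card_le_card hT), nuK_marg _ _ _ _ (by simp [hu, huT]), zero_add, mul_add,
      Finset.sum_filter, Finset.mul_sum]
    congr 1
    · congr 1
      rw [hN _ _ hT, hrv]
      have : T ∩ (G.neighborFinset u \ S0) = G.neighborFinset u ∩ T := by
        ext x
        simp only [Finset.mem_inter, Finset.mem_sdiff]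
        have := hdT x
        tauto
      rw [this]
      refine if_congr ?_ rfl rfl
      omega
    · refine Finset.sum_congr rfl fun v hv => ?_
      by_cases hvS : v ∈ S0
      · simp [hvS]
      rw [if_pos hvS]
      congr 1
      rw [hN _ _ hT, hrv]
      by_cases hvT : v ∈ T
      · simp [hvT]
      have : T ∩ (insert v ((G.neighborFinset v \ S0).erase u)) = G.neighborFinset v ∩ T := by
        ext x
        simp only [Finset.mem_inter, Finset.mem_insert, Finset.mem_erase, Finset.mem_sdiff]
        have h1 := hdT x
        have h2 : x ∈ T → x ≠ u := fun h e => huT (e ▸ h)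
        have h3 : x ∈ T → x ≠ v := fun h e => hvT (e ▸ h)
        tauto
      rw [this]
      refine if_congr ?_ rfl rfl
      simp only [Finset.mem_union, Finset.mem_inter, hvS, hvT]
      simp
      omega
  rw [Finset.sum_congr rfl hstep, Finset.sum_add_distrib]
  congr 1
  · rw [bw_marg' (G.neighborFinset u \ S0) M
      (by intro x hx
          simp only [hM, Finset.mem_sdiff, Finset.mem_erase, Finset.mem_univ, and_true,
            SimpleGraph.mem_neighborFinset] at hx ⊢
          exact ⟨hx.1.ne', hx.2⟩)
      (fun B => if ((B.card : ℕ) : ℤ) ≤ rv u then 1 else 0) k 0]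
    rw [← sum_C1, hsv, Finset.sum_powerset_apply_card (fun j =>
      bw (k + j) (0 + ((G.neighborFinset u \ S0).card - j)) * (if (j:ℤ) ≤ rv u then 1 else 0))]
    simp only [nsmul_eq_mul, zero_add]
  · rw [Finset.sum_comm]
    have hfin : ∀ v ∈ (G.neighborFinset u).filter (fun v => v ∉ S0),
        ∑ T ∈ M.powerset, bw (k + T.card) (0 + (M.card - T.card)) *
        (if v ∉ T ∩ (insert v ((G.neighborFinset v \ S0).erase u)) ∧
          (((T ∩ (insert v ((G.neighborFinset v \ S0).erase u))).card : ℕ) : ℤ) = rv v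
          then 1 else 0) =
        (chooseZ ((sv v : ℤ) - 1) (rv v) : ℝ) /
                  (chooseZ ((k : ℤ) + (sv v : ℤ)) ((k : ℤ) + rv v) : ℝ) /
                  ((k : ℝ) + (sv v : ℝ) + 1) := by
      intro v hv
      simp only [Finset.mem_filter, SimpleGraph.mem_neighborFinset] at hv
      set A := (G.neighborFinset v \ S0).erase u with hA
      have hvA : v ∉ A := by simp [hA]
      have humem : u ∈ G.neighborFinset v \ S0 := by simp [hv.1.symm, hu]
      have hAc : A.card = sv v - 1 := by rw [hA, Finset.card_erase_of_mem humem, hsv]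
      have hs1 : 1 ≤ sv v := by rw [hsv]; exact Finset.card_pos.2 ⟨u, humem⟩
      rw [bw_marg' (insert v A) M
        (by intro x hx
            simp only [hM, hA, Finset.mem_insert, Finset.mem_sdiff, Finset.mem_erase,
              Finset.mem_univ, and_true] at hx ⊢
            rcases hx with rfl | hx
            · exact ⟨hv.1.ne', hv.2⟩
            · exact ⟨hx.1, hx.2.2⟩)
        (fun B => if v ∉ B ∧ ((B.card : ℕ) : ℤ) = rv v then 1 else 0) k 0]
      rw [Finset.sum_powerset_insert hvA]
      rw [← sum_C2 _ _ hs1, ← hAc]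
      have hz : ∑ T ∈ A.powerset, bw (k + (insert v T).card)
          (0 + ((insert v A).card - (insert v T).card)) *
          (if v ∉ insert v T ∧ (((insert v T).card : ℕ) : ℤ) = rv v then (1:ℝ) else 0) = 0 :=
        Finset.sum_eq_zero fun T _ => by simp
      rw [hz, add_zero]
      have := Finset.sum_powerset_apply_card (fun j =>
        bw (k + j) (1 + (A.card - j)) * (if (j:ℤ) = rv v then (1:ℝ) else 0)) (x := A)
      simp only [nsmul_eq_mul] at this
      rw [← this]
      refine Finset.sum_congr rfl fun T hT => ?_
      rw [Finset.mem_powerset] at hT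
      have hvT : v ∉ T := fun h => hvA (hT h)
      have hc := Finset.card_le_card hT
      rw [Finset.card_insert_of_notMem hvA,
        show 0 + (A.card + 1 - T.card) = 1 + (A.card - T.card) by omega]
      simp [hvT]
    rw [Finset.sum_congr rfl hfin]
    symm
    apply Finset.sum_subset
    · intro v
      simp only [Finset.mem_filter]
      tauto
    · intro v hv hv2
      simp only [Finset.mem_filter] at hv hv2
      have hd : ¬ K ≤ G.degree v := fun h => hv2 ⟨hv.1, hv.2, h⟩
      have hc := Finset.card_sdiff_add_card_inter (G.neighborFinset v) S0
      rw [G.card_neighborFinset_eq_degree] at hc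
      have h0 : chooseZ ((sv v:ℤ) - 1) (rv v) = 0 := by
        have h1 := hsv v
        have h2 := hrv v
        unfold chooseZ
        split_ifs with h
        · rfl
        · apply Nat.choose_eq_zero_of_lt
          omega
      rw [h0]; simp
end

section
/- Let G=(V,E) be a finite simple undirected graph with n nodes, K ≥ 1 an integer, u ∈ V, S_0 ⊆ V\{u}, and β a probability distribution on {0,…,n−1} with β(s) > 0 for some s ≥ |S_0|. Then the semivalue past-aware game-theoretic centrality associated with ν_K satisfies φ^β_{ν_K}(u|S_0) = C_β · Σ_{s=0}^{n−1} (β(s)/C(n−1,s)) · Σ_{v ∈ N(u) ∪ {u}} |PC^s_u(v)|, where PC^s_u(v) = {S ⊆ V\{u} : |S| = s, S_0 ⊆ S, v ∼ S∪{u}, v ≁ S} and the relation is v ∼ S iff v ∈ S or |N(v) ∩ S| ≥ K. -/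
open Finset

theorem nuK_eq_aux {V : Type} [Fintype V] [DecidableEq V] (G : SimpleGraph V)
    [DecidableRel G.Adj] (K : ℕ) (S : Finset V) :
    nuK G K S =
      ((univ.filter (fun v => v ∈ S ∨ K ≤ (G.neighborFinset v ∩ S).card)).card : ℝ) := by
  unfold nuK
  rw [← Nat.cast_add, ← card_union_of_disjoint]
  · congr 2
    ext v
    simp only [mem_union, mem_filter, mem_univ, true_and]
    tauto
  · rw [disjoint_left]
    intro v hv h
    exact (mem_filter.1 h).2.1 hv

theorem nuK_diff_aux {V : Type} [Fintype V] [DecidableEq V] (G : SimpleGraph V)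
    [DecidableRel G.Adj] (K : ℕ) (u : V) (S : Finset V) :
    nuK G K (insert u S) - nuK G K S =
      ∑ v ∈ insert u (G.neighborFinset u),
        if ((v ∈ insert u S ∨ K ≤ (G.neighborFinset v ∩ insert u S).card) ∧
          ¬(v ∈ S ∨ K ≤ (G.neighborFinset v ∩ S).card)) then (1 : ℝ) else 0 := by
  have hmono : ∀ v, (v ∈ S ∨ K ≤ (G.neighborFinset v ∩ S).card) →
      (v ∈ insert u S ∨ K ≤ (G.neighborFinset v ∩ insert u S).card) := by
    rintro v (h | h)
    · exact Or.inl (mem_insert_of_mem h)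
    · exact Or.inr (h.trans (card_le_card (inter_subset_inter_left (subset_insert u S))))
  rw [nuK_eq_aux, nuK_eq_aux, card_filter, card_filter, Nat.cast_sum, Nat.cast_sum,
    ← sum_sub_distrib]
  symm
  rw [sum_subset (subset_univ (insert u (G.neighborFinset u)))]
  · refine sum_congr rfl fun v _ => ?_
    have := hmono v
    by_cases h1 : (v ∈ S ∨ K ≤ (G.neighborFinset v ∩ S).card)
    · rw [if_pos (this h1), if_pos h1, if_neg (fun h => h.2 h1)]; simp
    · by_cases h2 : (v ∈ insert u S ∨ K ≤ (G.neighborFinset v ∩ insert u S).card)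
      · rw [if_pos h2, if_neg h1, if_pos ⟨h2, h1⟩]; simp
      · rw [if_neg h2, if_neg h1, if_neg (fun h => h2 h.1)]; simp
  · intro v _ hv
    rw [mem_insert, not_or] at hv
    have hn : u ∉ G.neighborFinset v := by
      intro h
      apply hv.2
      rw [SimpleGraph.mem_neighborFinset] at h ⊢
      exact h.symm
    rw [if_neg]
    rintro ⟨h1, h2⟩
    rw [inter_insert_of_notMem hn, mem_insert] at h1
    tauto

/-- Theorem (semivalue PAGTC for `ν_K` via positive contributions):
`φ^β_{ν_K}(u|S_0) = C_β · Σ_{s=0}^{n−1} (β(s)/C(n−1,s)) · Σ_{v ∈ N(u) ∪ {u}} |PC^s_u(v)|`,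
where `PC^s_u(v) = {S ⊆ V∖{u} : |S| = s, S_0 ⊆ S, v ∼ S∪{u}, v ≁ S}` and the influence
relation is `v ∼ S` iff `v ∈ S` or `|N(v) ∩ S| ≥ K`. -/
theorem stmt6 {V : Type} [Fintype V] [DecidableEq V] (G : SimpleGraph V)
    [DecidableRel G.Adj] (K : ℕ) (hK : 1 ≤ K) (u : V) (S0 : Finset V) (hu : u ∉ S0)
    (β : ℕ → ℝ) (hβ0 : ∀ s, 0 ≤ β s)
    (hβ1 : ∑ s ∈ range (Fintype.card V), β s = 1)
    (hpos : ∃ s, S0.card ≤ s ∧ 0 < β s) :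
    pagtc (nuK G K) β u S0
      = (∑ s ∈ Icc S0.card (Fintype.card V - 1),
            β s * ((Fintype.card V - 1 - S0.card).choose (s - S0.card) : ℝ) /
              ((Fintype.card V - 1).choose s : ℝ))⁻¹ *
          ∑ s ∈ range (Fintype.card V),
            β s / ((Fintype.card V - 1).choose s : ℝ) *
              ∑ v ∈ insert u (G.neighborFinset u),
                ((((univ.erase u).powersetCard s).filter
                    (fun S => S0 ⊆ S ∧
                      (v ∈ insert u S ∨ K ≤ (G.neighborFinset v ∩ insert u S).card) ∧
                      ¬(v ∈ S ∨ K ≤ (G.neighborFinset v ∩ S).card))).card : ℝ) := by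
  unfold pagtc
  congr 1
  have hn : 0 < Fintype.card V := Fintype.card_pos_iff.2 ⟨u⟩
  have key : ∀ s, ∑ S ∈ ((univ.erase u).powersetCard s).filter (fun S => S0 ⊆ S),
        (nuK G K (insert u S) - nuK G K S) =
      ∑ v ∈ insert u (G.neighborFinset u),
                ((((univ.erase u).powersetCard s).filter
                    (fun S => S0 ⊆ S ∧
                      (v ∈ insert u S ∨ K ≤ (G.neighborFinset v ∩ insert u S).card) ∧
                      ¬(v ∈ S ∨ K ≤ (G.neighborFinset v ∩ S).card))).card : ℝ) := by
    intro s
    rw [sum_congr rfl fun S _ => nuK_diff_aux G K u S, sum_comm]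
    refine sum_congr rfl fun v _ => ?_
    rw [← filter_filter, card_filter, Nat.cast_sum]
    refine sum_congr rfl fun S _ => ?_
    split_ifs <;> simp
  rw [sum_congr rfl fun s _ => by rw [key s]]
  refine sum_subset ?_ ?_
  · intro s hs
    rw [mem_Icc] at hs
    rw [mem_range]
    omega
  · intro s hs hs'
    rw [mem_range] at hs
    rw [mem_Icc] at hs'
    rw [← key s, filter_eq_empty_iff.2, sum_empty, mul_zero]
    intro S hS hsub
    have := card_le_card hsub
    rw [(mem_powersetCard.1 hS).2] at this
    omega
end

section
/- Let G=(V,E) be a finite simple undirected graph with n nodes, K ≥ 1 an integer, u ∈ V, S_0 ⊆ V\{u}, and let s be an integer with |S_0| ≤ s ≤ n−1. For every v let s_v = |N(v)\S_0| and r_v = K − 1 − |N(v) ∩ S_0|. Then the semivalue past-aware game-theoretic centrality associated with ν_K for the Dirac distribution β = δ_s satisfies φ^{δ_s}_{ν_K}(u|S_0) = Σ_{j=0}^{min{s_u,r_u}} C(n−1−s, s_u−j)·C(s−|S_0|, j) / C(n−1−|S_0|, s_u) + Σ_{v ∈ N(u), v ∉ S_0, deg(v) ≥ K} C(n−1−s,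 s_v−r_v)·C(s−|S_0|, r_v)·(1 − r_v/s_v) / C(n−1−|S_0|, s_v), with the convention that C(x,y) = 0 if x or y is negative. -/
open Finset

lemma aux_swap (x y z : ℕ) : x.choose y * (x - y).choose z = x.choose z * (x - z).choose y := by
  by_cases h : y + z ≤ x
  · have h1 := Nat.choose_mul (n := x) (k := y + z) (s := y) (by omega)
    have h2 := Nat.choose_mul (n := x) (k := y + z) (s := z) (by omega)
    rw [show y + z - y = z by omega] at h1
    rw [show y + z - z = y by omega] at h2
    rw [← h1, ← h2, Nat.choose_symm_add]
  · have e1 : x.choose y * (x - y).choose z = 0 := by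
      by_cases hy : y ≤ x
      · rw [Nat.choose_eq_zero_of_lt (show x - y < z by omega), mul_zero]
      · rw [Nat.choose_eq_zero_of_lt (show x < y by omega), zero_mul]
    have e2 : x.choose z * (x - z).choose y = 0 := by
      by_cases hy : z ≤ x
      · rw [Nat.choose_eq_zero_of_lt (show x - z < y by omega), mul_zero]
      · rw [Nat.choose_eq_zero_of_lt (show x < z by omega), zero_mul]
    rw [e1, e2]

lemma aux_hyp (a t m j : ℕ) (ht : t ≤ a) (hm : m ≤ a) (hjt : j ≤ t) (hjm : j ≤ m) :
    a.choose m * (m.choose j * (a - m).choose (t - j))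
      = a.choose t * ((a - t).choose (m - j) * t.choose j) := by
  have h1 := Nat.choose_mul (n := a) (k := m) (s := j) hjm
  have h2 := Nat.choose_mul (n := a) (k := t) (s := j) hjt
  have h3 := aux_swap (a - j) (m - j) (t - j)
  rw [show a - j - (m - j) = a - m by omega, show a - j - (t - j) = a - t by omega] at h3
  calc _ = (a.choose m * m.choose j) * (a - m).choose (t - j) := by ring
    _ = a.choose j * ((a - j).choose (m - j) * (a - m).choose (t - j)) := by rw [h1]; ring
    _ = (a.choose j * (a - j).choose (t - j)) * (a - t).choose (m - j) := by rw [h3]; ring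
    _ = _ := by rw [← h2]; ring

lemma aux_count {V : Type} [DecidableEq V] (A B : Finset V) (hB : B ⊆ A) (t j : ℕ) (hj : j ≤ t) :
    ((A.powersetCard t).filter (fun T => (B ∩ T).card = j)).card
      = B.card.choose j * (A.card - B.card).choose (t - j) := by
  rw [← card_sdiff_of_subset hB, ← card_powersetCard, ← card_powersetCard, ← card_product]
  refine card_bij' (fun T _ => (B ∩ T, T \ B)) (fun p _ => p.1 ∪ p.2) ?_ ?_ ?_ ?_
  · intro T hT
    simp only [mem_filter, mem_powersetCard, mem_product] at hT ⊢
    have := card_sdiff_add_card_inter T B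
    rw [inter_comm] at this
    refine ⟨⟨inter_subset_left, hT.2⟩, sdiff_subset_sdiff hT.1.1 le_rfl, by omega⟩
  · rintro ⟨P, Q⟩ h
    simp only [mem_filter, mem_powersetCard, mem_product] at h ⊢
    obtain ⟨⟨h1, h2⟩, h3, h4⟩ := h
    have hd : Disjoint P Q := by
      rw [disjoint_left]; intro x hx hx'
      exact (mem_sdiff.1 (h3 hx')).2 (h1 hx)
    have he : B ∩ (P ∪ Q) = P := by
      ext x
      have := @h1 x
      have := @h3 x
      simp only [mem_sdiff, mem_inter, mem_union] at *
      tauto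
    refine ⟨⟨union_subset (h1.trans hB) (h3.trans sdiff_subset), ?_⟩, by rw [he, h2]⟩
    rw [card_union_of_disjoint hd]; omega
  · intro T hT
    ext x; simp only [mem_union, mem_inter, mem_sdiff]; tauto
  · rintro ⟨P, Q⟩ h
    simp only [mem_powersetCard, mem_product] at h
    obtain ⟨⟨h1, h2⟩, h3, h4⟩ := h
    refine Prod.ext ?_ ?_ <;> ext x <;> have := @h1 x <;> have := @h3 x <;>
      simp only [mem_sdiff, mem_inter, mem_union] at * <;> tauto

lemma aux_count0 {V : Type} [DecidableEq V] (A B : Finset V) (t j : ℕ) (hj : t < j) :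
    ((A.powersetCard t).filter (fun T => (B ∩ T).card = j)).card = 0 := by
  rw [card_eq_zero, filter_eq_empty_iff]
  intro T hT h
  rw [mem_powersetCard] at hT
  have := card_le_card (inter_subset_right (s₁ := B) (s₂ := T))
  omega

/-- First-type count. -/
lemma aux_first {V : Type} [DecidableEq V] (A B : Finset V) (hB : B ⊆ A) (t j : ℕ)
    (ht : t ≤ A.card) (hj : j ≤ B.card) :
    ((A.powersetCard t).filter (fun T => (B ∩ T).card = j)).card * A.card.choose B.card
      = A.card.choose t * ((A.card - t).choose (B.card - j) * t.choose j) := by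
  by_cases h : j ≤ t
  · rw [aux_count A B hB t j h, mul_comm,
      aux_hyp _ _ _ _ ht (card_le_card hB) h hj]
  · rw [aux_count0 A B t j (by omega), Nat.choose_eq_zero_of_lt (show t < j by omega)]; simp

/-- Second-type count, `a = |A'| + 1`, `m = |B| + 1`. -/
lemma aux_second {V : Type} [DecidableEq V] (A B : Finset V) (hB : B ⊆ A) (t j : ℕ)
    (ht : t ≤ A.card + 1) (hj : j ≤ B.card) :
    ((A.powersetCard t).filter (fun T => (B ∩ T).card = j)).card *
        ((A.card + 1).choose (B.card + 1)) * (B.card + 1)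
      = (A.card + 1).choose t * ((A.card + 1 - t).choose (B.card + 1 - j) * t.choose j) *
        (B.card + 1 - j) := by
  by_cases h : j ≤ t
  · have h1 := Nat.choose_mul_succ_eq B.card j
    have hc := card_le_card hB
    rw [← aux_hyp _ _ _ _ ht (by omega) h (by omega), aux_count A B hB t j h,
      show A.card + 1 - (B.card + 1) = A.card - B.card by omega]
    calc _ = (B.card.choose j * (B.card + 1)) * ((A.card - B.card).choose (t - j) *
              (A.card + 1).choose (B.card + 1)) := by ring
      _ = _ := by rw [h1]; ring
  · rw [aux_count0 A B t j (by omega), Nat.choose_eq_zero_of_lt (show t < j by omega)]; simp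

lemma aux_marg {V : Type} [Fintype V] [DecidableEq V] (G : SimpleGraph V) [DecidableRel G.Adj]
    (K : ℕ) (u : V) (S : Finset V) (hu : u ∉ S) :
    nuK G K (insert u S) - nuK G K S
      = (if (G.neighborFinset u ∩ S).card < K then (1 : ℝ) else 0) +
        ∑ v ∈ G.neighborFinset u,
          if v ∉ S ∧ (G.neighborFinset v ∩ S).card + 1 = K then (1 : ℝ) else 0 := by
  have key : ∀ v : V,
      (if v ∉ insert u S ∧ K ≤ (G.neighborFinset v ∩ insert u S).card then (1 : ℝ) else 0)
      = (if v ∉ S ∧ K ≤ (G.neighborFinset v ∩ S).card then (1 : ℝ) else 0)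
        - (if v = u then (if K ≤ (G.neighborFinset u ∩ S).card then (1 : ℝ) else 0) else 0)
        + (if v ∈ G.neighborFinset u then
            (if v ∉ S ∧ (G.neighborFinset v ∩ S).card + 1 = K then (1 : ℝ) else 0) else 0) := by
    intro v
    by_cases hvu : v = u
    · subst hvu
      simp [hu]
    · by_cases ha : G.Adj u v
      · have : (G.neighborFinset v ∩ insert u S).card = (G.neighborFinset v ∩ S).card + 1 := by
          rw [inter_insert_of_mem (by simpa using ha.symm), card_insert_of_notMem (by simp [hu])]
        rw [this]
        by_cases hS : v ∈ S
        · simp [hS, hvu]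
        · simp only [mem_insert, hvu, hS, ha, SimpleGraph.mem_neighborFinset]
          simp only [or_self, not_false_eq_true, true_and, if_true, if_false]
          split_ifs <;> first | omega | norm_num
      · have : (G.neighborFinset v ∩ insert u S) = (G.neighborFinset v ∩ S) := by
          rw [inter_insert_of_notMem (by simpa using fun h => ha h.symm)]
        rw [this]
        simp [hvu, ha]
  unfold nuK
  rw [card_insert_of_notMem hu]
  simp only [card_filter, Nat.cast_sum, Nat.cast_ite, Nat.cast_one, Nat.cast_zero]
  rw [sum_congr rfl (fun v _ => key v), sum_add_distrib, sum_sub_distrib]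
  simp only [sum_ite_eq', sum_ite_mem, mem_univ, if_true, univ_inter]
  push_cast
  split_ifs <;> first | omega | ring

lemma aux_reindex {V : Type} [Fintype V] [DecidableEq V] (u : V) (S0 : Finset V) (hu : u ∉ S0)
    (s : ℕ) (hs : S0.card ≤ s) (f : Finset V → ℝ) :
    ∑ S ∈ ((univ.erase u).powersetCard s).filter (fun S => S0 ⊆ S), f S
      = ∑ T ∈ ((univ.erase u) \ S0).powersetCard (s - S0.card), f (S0 ∪ T) := by
  refine sum_bij' (fun S _ => S \ S0) (fun T _ => S0 ∪ T) ?_ ?_ ?_ ?_ ?_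
  · intro S hS
    simp only [mem_filter, mem_powersetCard] at hS ⊢
    refine ⟨sdiff_subset_sdiff hS.1.1 le_rfl, ?_⟩
    rw [card_sdiff_of_subset hS.2, hS.1.2]
  · intro T hT
    simp only [mem_filter, mem_powersetCard] at hT ⊢
    have hd : Disjoint S0 T := by
      rw [disjoint_left]; intro x hx hx'
      exact (mem_sdiff.1 (hT.1 hx')).2 hx
    refine ⟨⟨union_subset ?_ (hT.1.trans sdiff_subset), ?_⟩, subset_union_left⟩
    · intro x hx
      rw [mem_erase]
      exact ⟨fun h => hu (h ▸ hx), mem_univ _⟩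
    · rw [card_union_of_disjoint hd]; omega
  · intro S hS
    simp only [mem_filter] at hS
    exact union_sdiff_of_subset hS.2
  · intro T hT
    simp only [mem_powersetCard] at hT
    ext x
    have hsub := hT.1
    have := @hsub x
    simp only [mem_sdiff, mem_union] at *
    tauto
  · intro S hS
    simp only [mem_filter] at hS
    rw [union_sdiff_of_subset hS.2]

lemma aux_inter {V : Type} [DecidableEq V] (N S0 T : Finset V) (hd : Disjoint S0 T) :
    (N ∩ (S0 ∪ T)).card = (N ∩ S0).card + ((N \ S0) ∩ T).card := by
  rw [← card_union_of_disjoint]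
  · congr 1
    ext x
    have hd2 := disjoint_left.1 hd
    have := @hd2 x
    simp only [mem_sdiff, mem_union, mem_inter]
    tauto
  · rw [disjoint_left]
    intro x hx
    simp only [mem_sdiff, mem_inter] at *
    tauto

theorem stmt7 {V : Type} [Fintype V] [DecidableEq V] (G : SimpleGraph V)
    [DecidableRel G.Adj] (K : ℕ) (hK : 1 ≤ K) (u : V) (S0 : Finset V) (hu : u ∉ S0)
    (s : ℕ) (hs1 : S0.card ≤ s) (hs2 : s ≤ Fintype.card V - 1)
    (sv : V → ℕ) (hsv : ∀ v, sv v = (G.neighborFinset v \ S0).card)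
    (rv : V → ℤ) (hrv : ∀ v, rv v = (K : ℤ) - 1 - ((G.neighborFinset v ∩ S0).card : ℤ)) :
    pagtc (nuK G K) (fun s' => if s' = s then (1 : ℝ) else 0) u S0
      = (∑ j ∈ range ((min ((sv u : ℤ)) (rv u) + 1).toNat),
            ((Fintype.card V - 1 - s).choose (sv u - j) : ℝ) *
              ((s - S0.card).choose j : ℝ) /
              ((Fintype.card V - 1 - S0.card).choose (sv u) : ℝ))
        + ∑ v ∈ (G.neighborFinset u).filter (fun v => v ∉ S0 ∧ K ≤ G.degree v),
            (chooseZ ((Fintype.card V : ℤ) - 1 - s) ((sv v : ℤ) - rv v) : ℝ) *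
              (chooseZ ((s : ℤ) - S0.card) (rv v) : ℝ) *
              (1 - (rv v : ℝ) / (sv v : ℝ)) /
              ((Fintype.card V - 1 - S0.card).choose (sv v) : ℝ) := by
  set n := Fintype.card V with hn
  set A : Finset V := (univ.erase u) \ S0 with hA
  have hS0 : S0 ⊆ univ.erase u := by
    intro x hx
    rw [mem_erase]
    exact ⟨fun h => hu (h ▸ hx), mem_univ _⟩
  have hAc : A.card = n - 1 - S0.card := by
    rw [hA, card_sdiff_of_subset hS0, card_erase_of_mem (mem_univ _), card_univ]
  set t := s - S0.card with ht
  have htA : t ≤ A.card := by omega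
  have hat : n - 1 - s = A.card - t := by omega
  have hn1 : 1 ≤ n := Fintype.card_pos_iff.2 ⟨u⟩
  have hmem : s ∈ Icc S0.card (n - 1) := mem_Icc.2 ⟨hs1, hs2⟩
  have hC0 : (0 : ℝ) < A.card.choose t := by exact_mod_cast Nat.choose_pos htA
  have hCn : (0 : ℝ) < (n - 1).choose s := by exact_mod_cast Nat.choose_pos hs2
  have hTd : ∀ T ∈ A.powersetCard t, Disjoint S0 T ∧ u ∉ T := by
    intro T hT
    rw [mem_powersetCard] at hT
    refine ⟨?_, fun h => ?_⟩
    · rw [disjoint_left]; intro x hx hx'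
      exact (mem_sdiff.1 (hT.1 hx')).2 hx
    · have := hT.1 h
      simp [hA] at this
  -- reduction to an average over `T`
  have hred : pagtc (nuK G K) (fun s' => if s' = s then (1 : ℝ) else 0) u S0
      = (∑ T ∈ A.powersetCard t, (nuK G K (insert u (S0 ∪ T)) - nuK G K (S0 ∪ T)))
        / A.card.choose t := by
    unfold pagtc
    simp only [ite_mul, zero_mul, one_mul, ite_div, zero_div, sum_ite_eq', ← hn, hmem, if_true]
    rw [aux_reindex u S0 hu s hs1, ← hAc, ← hA, ← ht]
    field_simp
  rw [hred, div_eq_iff hC0.ne', add_mul, sum_mul, sum_mul]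
  have hsplit : ∀ T ∈ A.powersetCard t, nuK G K (insert u (S0 ∪ T)) - nuK G K (S0 ∪ T)
      = (if (G.neighborFinset u ∩ S0).card + ((G.neighborFinset u \ S0) ∩ T).card < K
          then (1 : ℝ) else 0) +
        ∑ v ∈ G.neighborFinset u,
          if v ∉ S0 ∪ T ∧ (G.neighborFinset v ∩ S0).card +
            ((G.neighborFinset v \ S0) ∩ T).card + 1 = K then (1 : ℝ) else 0 := by
    intro T hT
    obtain ⟨h1, h2⟩ := hTd T hT
    rw [aux_marg G K u (S0 ∪ T) (by simp [hu, h2])]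
    simp only [aux_inter _ _ _ h1]
  rw [sum_congr rfl hsplit, sum_add_distrib, sum_comm]
  congr 1
  · -- first part
    have hB : G.neighborFinset u \ S0 ⊆ A := by
      intro x hx
      simp only [hA, mem_sdiff, mem_erase, SimpleGraph.mem_neighborFinset] at hx ⊢
      exact ⟨⟨hx.1.ne', mem_univ _⟩, hx.2⟩
    rw [← Nat.cast_one, ← Nat.cast_zero]
    simp only [← Nat.cast_ite, ← Nat.cast_sum]
    rw [← card_filter]
    rw [card_eq_sum_card_fiberwise (f := fun T => ((G.neighborFinset u \ S0) ∩ T).card)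
      (t := range ((min ((sv u : ℤ)) (rv u) + 1).toNat))]
    · push_cast
      refine sum_congr rfl fun j hj => ?_
      have hj' : j ≤ (G.neighborFinset u \ S0).card ∧ (G.neighborFinset u ∩ S0).card + j < K := by
        have h1 := hsv u
        have h2 := hrv u
        rw [mem_range] at hj
        omega
      rw [filter_filter]
      have he : (A.powersetCard t).filter (fun T => (G.neighborFinset u ∩ S0).card +
            ((G.neighborFinset u \ S0) ∩ T).card < K ∧ ((G.neighborFinset u \ S0) ∩ T).card = j)
          = (A.powersetCard t).filter (fun T => ((G.neighborFinset u \ S0) ∩ T).card = j) := by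
        refine filter_congr fun T _ => ⟨fun h => h.2, fun h => ⟨?_, h⟩⟩
        omega
      rw [he]
      have hf := aux_first A _ hB t j htA hj'.1
      have hpos : (0 : ℝ) < A.card.choose (G.neighborFinset u \ S0).card := by
        exact_mod_cast Nat.choose_pos (card_le_card hB)
      rw [hsv u, ← hAc, hat, div_mul_eq_mul_div, eq_div_iff hpos.ne']
      rw [mul_comm (_ * _) ((A.card.choose t : ℕ) : ℝ)]
      exact_mod_cast hf
    · intro T hT
      have hT := (mem_filter.1 hT).2
      have h1 := hsv u
      have h2 := hrv u
      have h3 := card_le_card (inter_subset_left (s₁ := G.neighborFinset u \ S0) (s₂ := T))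
      simp only [coe_range, Set.mem_Iio]
      omega
  · -- second part
    rw [sum_filter]
    refine sum_congr rfl fun v hv => ?_
    rw [SimpleGraph.mem_neighborFinset] at hv
    have hdeg : G.degree v = (G.neighborFinset v ∩ S0).card + sv v := by
      rw [hsv v, ← SimpleGraph.card_neighborFinset_eq_degree, add_comm,
        card_sdiff_add_card_inter]
    by_cases hvS : v ∈ S0
    · simp [hvS]
    set B := (G.neighborFinset v \ S0).erase u with hBd
    have hub : u ∈ G.neighborFinset v \ S0 := by simp [hu, hv.symm]
    have hBc : sv v = B.card + 1 := by
      rw [hsv v, hBd, card_erase_add_one hub]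
    have hvA : v ∈ A := by simp [hA, hvS, hv.ne']
    have hAe : A.card = (A.erase v).card + 1 := by rw [card_erase_add_one hvA]
    have hB : B ⊆ A.erase v := by
      intro x hx
      simp only [hBd, hA, mem_sdiff, mem_erase, SimpleGraph.mem_neighborFinset] at hx ⊢
      exact ⟨hx.2.1.ne', ⟨hx.1, mem_univ _⟩, hx.2.2⟩
    have hBT : ∀ T ∈ A.powersetCard t, (G.neighborFinset v \ S0) ∩ T = B ∩ T := by
      intro T hT
      rw [hBd, erase_inter, erase_eq_of_notMem]
      simp [(hTd T hT).2]
    have hcnt : (∑ T ∈ A.powersetCard t, if v ∉ S0 ∪ T ∧ (G.neighborFinset v ∩ S0).card +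
            ((G.neighborFinset v \ S0) ∩ T).card + 1 = K then (1 : ℝ) else 0)
        = (((A.erase v).powersetCard t).filter
            (fun T => (G.neighborFinset v ∩ S0).card + (B ∩ T).card + 1 = K)).card := by
      rw [sum_boole]
      congr 2
      ext T
      simp only [mem_filter, mem_union, not_or]
      constructor
      · rintro ⟨h1, ⟨h2, h3⟩, h4⟩
        rw [hBT T h1] at h4
        rw [mem_powersetCard] at h1 ⊢
        exact ⟨⟨subset_erase.2 ⟨h1.1, h3⟩, h1.2⟩, h4⟩
      · rintro ⟨h1, h4⟩
        rw [mem_powersetCard, subset_erase] at h1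
        have h5 : T ∈ A.powersetCard t := mem_powersetCard.2 ⟨h1.1.1, h1.2⟩
        rw [hBT T h5]
        exact ⟨h5, ⟨hvS, h1.1.2⟩, h4⟩
    rw [hcnt]
    have hr := hrv v
    have hBle : ∀ T, (B ∩ T).card ≤ B.card := fun T => card_le_card inter_subset_left
    by_cases hdK : K ≤ G.degree v
    · rw [if_pos ⟨hvS, hdK⟩]
      by_cases hr0 : rv v < 0
      · rw [show chooseZ ((s : ℤ) - S0.card) (rv v) = 0 by simp [chooseZ, hr0]]
        rw [filter_false_of_mem]
        · simp
        · intro T _; omega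
      · obtain ⟨j, hj⟩ := Int.eq_ofNat_of_zero_le (not_lt.1 hr0)
        have hjB : j ≤ B.card := by omega
        have he : ((A.erase v).powersetCard t).filter
            (fun T => (G.neighborFinset v ∩ S0).card + (B ∩ T).card + 1 = K)
            = ((A.erase v).powersetCard t).filter (fun T => (B ∩ T).card = j) := by
          refine filter_congr fun T _ => ?_
          omega
        have hf := aux_second (A.erase v) B hB t j (by omega) hjB
        rw [← hAe] at hf
        have c1 : chooseZ ((n : ℤ) - 1 - s) ((sv v : ℤ) - rv v)
            = (A.card - t).choose (B.card + 1 - j) := by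
          unfold chooseZ
          rw [if_neg (by omega)]
          congr 1 <;> omega
        have c2 : chooseZ ((s : ℤ) - S0.card) (rv v) = t.choose j := by
          unfold chooseZ
          rw [if_neg (by omega)]
          congr 1 <;> omega
        rw [he, c1, c2, hj, ← hAc, hBc]
        have hpos : (0 : ℝ) < A.card.choose (B.card + 1) := by
          have := card_le_card hB
          exact_mod_cast Nat.choose_pos (by omega)
        have hf' := congrArg (Nat.cast : ℕ → ℝ) hf
        push_cast [Nat.cast_sub (show j ≤ B.card + 1 by omega)] at hf'
        have hb : (0 : ℝ) < (B.card : ℝ) + 1 := by positivity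
        push_cast
        field_simp
        linarith
    · rw [if_neg (fun h => hdK h.2), filter_false_of_mem]
      · simp
      · intro T _
        have := hBle T
        omega
end

section
/- Let G=(V,E) be a finite simple undirected graph with n nodes, K ≥ 1 an integer, u ∈ V, S_0 ⊆ V\{u}, and s an integer with |S_0| ≤ s ≤ n−1. Let v ∈ N(u) with v ∉ S_0, and set s_v = |N(v)\S_0| and r_v = K − 1 − |N(v) ∩ S_0|. Then the number of subsets S with S_0 ⊆ S ⊆ V\{u}, |S| = s, such that v ∼ S∪{u} but v ≁ S (where v ∼ S iff v ∈ S or |N(v) ∩ S| ≥ K) equals C(s_v − 1, r_v) · C(n − 1 − |S_0| − s_v, s − |S_0| − r_v), with the convention that C(x,y) = 0 if x or y is negative. -/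
open Finset

theorem inter_aux {V : Type} [DecidableEq V] (S0 A B X Y : Finset V)
    (d1 : Disjoint S0 A) (d2 : Disjoint S0 B) (d3 : Disjoint A B) (hX : X ⊆ A) (hY : Y ⊆ B) :
    (S0 ∪ X ∪ Y) ∩ A = X ∧ (S0 ∪ X ∪ Y) ∩ B = Y := by
  rw [disjoint_left] at d1 d2 d3
  constructor <;>
  · ext x
    have := @hX x
    have := @hY x
    have := @d1 x
    have := @d2 x
    have := @d3 x
    simp only [mem_union, mem_inter]
    tauto

theorem union_aux {V : Type} [DecidableEq V] (S0 A B S : Finset V)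
    (h1 : S0 ⊆ S) (h2 : S ⊆ S0 ∪ A ∪ B) : S0 ∪ (S ∩ A) ∪ (S ∩ B) = S := by
  ext x
  have := @h1 x
  have := @h2 x
  simp only [mem_union, mem_inter] at *
  tauto

/-- Counting positive contributions of a neighbor `v ∈ N(u)`, `v ∉ S_0`: the number of
subsets `S` with `S_0 ⊆ S ⊆ V∖{u}`, `|S| = s`, such that `v ∼ S∪{u}` but `v ≁ S`
(where `v ∼ S` iff `v ∈ S` or `|N(v) ∩ S| ≥ K`) equals
`C(s_v − 1, r_v) · C(n − 1 − |S_0| − s_v, s − |S_0| − r_v)`, where `s_v = |N(v)∖S_0|`,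
`r_v = K − 1 − |N(v) ∩ S_0|`, and `C(x,y) = 0` if `x` or `y` is negative. -/
theorem stmt9 {V : Type} [Fintype V] [DecidableEq V] (G : SimpleGraph V)
    [DecidableRel G.Adj] (K : ℕ) (hK : 1 ≤ K) (u v : V) (S0 : Finset V) (hu : u ∉ S0)
    (huv : v ∈ G.neighborFinset u) (hv : v ∉ S0)
    (s : ℕ) (hs1 : S0.card ≤ s) (hs2 : s ≤ Fintype.card V - 1)
    (sv : ℕ) (hsv : sv = (G.neighborFinset v \ S0).card)
    (rv : ℤ) (hrv : rv = (K : ℤ) - 1 - ((G.neighborFinset v ∩ S0).card : ℤ)) :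
    (((univ.erase u).powersetCard s).filter
        (fun S => S0 ⊆ S ∧
          (v ∈ insert u S ∨ K ≤ (G.neighborFinset v ∩ insert u S).card) ∧
          ¬(v ∈ S ∨ K ≤ (G.neighborFinset v ∩ S).card))).card
      = chooseZ ((sv : ℤ) - 1) rv *
          chooseZ ((Fintype.card V : ℤ) - 1 - S0.card - sv)
            ((s : ℤ) - S0.card - rv) := by
  have hadj : G.Adj u v := by simpa using huv
  have hne : u ≠ v := hadj.ne
  set N := G.neighborFinset v with hN
  have huN : u ∈ N := by simp [hN, hadj.symm]
  have hvN : v ∉ N := by simp [hN]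
  clear_value N
  obtain ⟨A, hA⟩ : ∃ A, A = (N \ S0).erase u := ⟨_, rfl⟩
  obtain ⟨B, hB⟩ : ∃ B, B = univ \ (insert v (S0 ∪ N)) := ⟨_, rfl⟩
  have hAc : A.card + 1 = sv := by
    rw [hA, hsv]
    exact card_erase_add_one (by simp [huN, hu])
  have hBc : B.card + 1 + S0.card + sv = Fintype.card V := by
    have h1 : B.card + (insert v (S0 ∪ N)).card = Fintype.card V := by
      rw [hB, card_sdiff_add_card_eq_card (subset_univ _), card_univ]
    have h2 : (insert v (S0 ∪ N)).card = (S0 ∪ N).card + 1 :=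
      card_insert_of_notMem (by simp [hv, hvN])
    have h3 : (S0 ∪ N).card = S0.card + sv := by
      rw [hsv, ← card_union_of_disjoint disjoint_sdiff, union_sdiff_self_eq_union]
    omega
  have d1 : Disjoint S0 A := by
    rw [disjoint_left]; intro x; simp [hA]; tauto
  have d2 : Disjoint S0 B := by
    rw [disjoint_left]; intro x; simp [hB]; tauto
  have d3 : Disjoint A B := by
    rw [disjoint_left]; intro x; simp [hA, hB]; tauto
  have hcount : ∀ S, S0 ⊆ S → S ⊆ S0 ∪ A ∪ B →
      S.card = S0.card + (S ∩ A).card + (S ∩ B).card := by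
    intro S h1 h2
    rw [← card_union_of_disjoint (d1.mono_right inter_subset_right),
      ← card_union_of_disjoint]
    · congr 1
      ext x
      have := @h1 x
      have := @h2 x
      simp only [mem_union, mem_inter] at *
      tauto
    · rw [disjoint_union_left]
      exact ⟨d2.mono_right inter_subset_right, d3.mono inter_subset_right inter_subset_right⟩
  have hNS : ∀ S, S0 ⊆ S → u ∉ S → (N ∩ S).card = (N ∩ S0).card + (S ∩ A).card := by
    intro S h1 h2
    rw [← card_union_of_disjoint (d1.mono inter_subset_right inter_subset_right)]
    congr 1
    ext x
    have := @h1 x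
    have : x = u → x ∉ S := by rintro rfl; exact h2
    simp only [mem_union, mem_inter, hA, mem_erase, mem_sdiff] at *
    tauto
  have hmem : ∀ S, (S ∈ ((univ.erase u).powersetCard s).filter
        (fun S => S0 ⊆ S ∧
          (v ∈ insert u S ∨ K ≤ (N ∩ insert u S).card) ∧
          ¬(v ∈ S ∨ K ≤ (N ∩ S).card))) ↔
      S0 ⊆ S ∧ S ⊆ S0 ∪ A ∪ B ∧ ((S ∩ A).card : ℤ) = rv ∧
        ((S ∩ B).card : ℤ) = (s : ℤ) - S0.card - rv := by
    intro S
    have huU : u ∉ S0 ∪ A ∪ B := by simp [hA, hB, hu, huN]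
    have hvU : v ∉ S0 ∪ A ∪ B := by simp [hA, hB, hv, hvN]
    have hins : u ∉ S → (N ∩ insert u S).card = (N ∩ S).card + 1 := by
      intro h
      rw [inter_insert_of_mem huN, card_insert_of_notMem (by simp [h])]
    simp only [mem_filter, mem_powersetCard, mem_insert, hne.symm, false_or, not_or, not_le]
    constructor
    · rintro ⟨⟨h1, h2⟩, h3, h4, h5, h6⟩
      have huS : u ∉ S := fun h => by simpa using h1 h
      have hsub : S ⊆ S0 ∪ A ∪ B := by
        intro x hx
        have e1 : x ≠ u := by rintro rfl; exact huS hx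
        have e2 : x ≠ v := by rintro rfl; exact h5 hx
        simp only [mem_union, hA, hB, mem_erase, mem_sdiff, mem_univ, mem_insert]
        tauto
      have := hcount S h3 hsub
      have := hNS S h3 huS
      have := hins huS
      have h7 := h4.resolve_left h5
      refine ⟨h3, hsub, ?_, ?_⟩ <;> omega
    · rintro ⟨h3, hsub, h1, h2⟩
      have huS : u ∉ S := fun h => huU (hsub h)
      have hvS : v ∉ S := fun h => hvU (hsub h)
      have := hcount S h3 hsub
      have := hNS S h3 huS
      have := hins huS
      refine ⟨⟨?_, by omega⟩, h3, Or.inr (by omega), hvS, by omega⟩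
      intro x hx
      simp only [mem_erase, mem_univ, and_true]
      rintro rfl
      exact huS hx
  by_cases hneg : rv < 0 ∨ (s : ℤ) - S0.card - rv < 0
  · have hz : chooseZ ((sv : ℤ) - 1) rv *
          chooseZ ((Fintype.card V : ℤ) - 1 - S0.card - sv)
            ((s : ℤ) - S0.card - rv) = 0 := by
      rcases hneg with h | h <;> simp [chooseZ, h]
    rw [hz, card_eq_zero, eq_empty_iff_forall_notMem]
    intro S hS
    obtain ⟨-, -, h1, h2⟩ := (hmem S).1 hS
    omega
  · push Not at hneg
    obtain ⟨r, hr⟩ := Int.eq_ofNat_of_zero_le hneg.1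
    obtain ⟨t, ht⟩ := Int.eq_ofNat_of_zero_le hneg.2
    have e1 : (sv : ℤ) - 1 = (A.card : ℤ) := by omega
    have e2 : (Fintype.card V : ℤ) - 1 - S0.card - sv = (B.card : ℤ) := by omega
    have hc : ∀ a b : ℕ, chooseZ (a : ℤ) (b : ℤ) = a.choose b := by
      intro a b
      have h : ¬ ((a : ℤ) < 0 ∨ (b : ℤ) < 0) := by omega
      simp [chooseZ, h]
    rw [e1, e2, ht, hr, hc, hc, ← card_powersetCard, ← card_powersetCard, ← card_product]
    rw [ht, hr] at hmem
    have hinv := fun X Y => inter_aux S0 A B X Y d1 d2 d3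
    refine card_nbij' (fun S => (S ∩ A, S ∩ B)) (fun p => S0 ∪ p.1 ∪ p.2) ?_ ?_ ?_ ?_
    · intro S hS
      obtain ⟨-, -, h1, h2⟩ := (hmem S).1 hS
      simp only [coe_product, Set.mem_prod, mem_coe, mem_powersetCard]
      exact ⟨⟨inter_subset_right, by exact_mod_cast h1⟩,
        ⟨inter_subset_right, by exact_mod_cast h2⟩⟩
    · rintro ⟨X, Y⟩ hp
      simp only [coe_product, Set.mem_prod, mem_coe, mem_powersetCard] at hp
      obtain ⟨⟨hX, hXc⟩, hY, hYc⟩ := hp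
      obtain ⟨i1, i2⟩ := hinv X Y hX hY
      refine (hmem _).2 ⟨?_, ?_, ?_, ?_⟩
      · exact subset_union_left.trans subset_union_left
      · exact union_subset_union (union_subset_union subset_rfl hX) hY
      · simp only [i1, hXc]
      · simp only [i2, hYc]
    · intro S hS
      obtain ⟨h1, h2, -, -⟩ := (hmem S).1 hS
      exact union_aux S0 A B S h1 h2
    · rintro ⟨X, Y⟩ hp
      simp only [coe_product, Set.mem_prod, mem_coe, mem_powersetCard] at hp
      obtain ⟨⟨hX, hXc⟩, hY, hYc⟩ := hp
      obtain ⟨i1, i2⟩ := hinv X Y hX hY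
      exact Prod.ext i1 i2
end

section
/- For every integer K ≥ 2, the full influence ν*_K is not submodular: there exist a finite simple undirected graph G=(V,E), sets S ⊆ T ⊆ V, and a node u ∈ V \ T such that ν*_K(u|S) < ν*_K(u|T). (For instance, for K = 3, take V = {w, v, u, z} with z adjacent to each of w, v, u, S = {v}, and T = {v, w}: then ν*_3(u|S) = 1 < 2 = ν*_3(u|T).) -/
open Finset

/-- One round of `K`-complex contagion: every inactive node with at least `K` active
neighbors becomes active. -/
noncomputable def ccStep {V : Type} [Fintype V] [DecidableEq V] (G : SimpleGraph V)
    (K : ℕ) (U : Finset V) : Finset V :=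
  letI : DecidableRel G.Adj := Classical.decRel _
  U ∪ univ.filter (fun v => v ∉ U ∧ K ≤ (G.neighborFinset v ∩ U).card)

/-- The full influence `ν*_K(S)`: the number of active nodes in the fixed point of the
`K`-complex-contagion dynamics started from the seed set `S` (reached after at most `|V|`
rounds). -/
noncomputable def nuStar {V : Type} [Fintype V] [DecidableEq V] (G : SimpleGraph V)
    (K : ℕ) (S : Finset V) : ℝ :=
  (((ccStep G K)^[Fintype.card V] S).card : ℝ)

theorem ccStep_small {V : Type} [Fintype V] [DecidableEq V] (G : SimpleGraph V)
    (K : ℕ) (U : Finset V) (h : U.card < K) : ccStep G K U = U := by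
  unfold ccStep
  ext v
  simp only [mem_union, mem_filter, mem_univ, true_and, or_iff_left_iff_imp]
  rintro ⟨_, h2⟩
  exact absurd (h2.trans (card_le_card inter_subset_right)) (by omega)

theorem nuStar_small {V : Type} [Fintype V] [DecidableEq V] (G : SimpleGraph V)
    (K : ℕ) (U : Finset V) (h : U.card < K) : nuStar G K U = U.card := by
  unfold nuStar
  rw [Function.iterate_fixed (ccStep_small G K U h)]

theorem ccStep_univ {V : Type} [Fintype V] [DecidableEq V] (G : SimpleGraph V)
    (K : ℕ) : ccStep G K univ = univ := by
  unfold ccStep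
  simp

theorem ccStep_top {V : Type} [Fintype V] [DecidableEq V]
    (K : ℕ) (z : V) (h : K ≤ (univ.erase z : Finset V).card) :
    ccStep (⊤ : SimpleGraph V) K (univ.erase z) = univ := by
  unfold ccStep
  ext v
  simp only [mem_union, mem_filter, mem_univ, true_and, iff_true]
  by_cases hv : v = z
  · right
    subst hv
    refine ⟨by simp, h.trans (card_le_card ?_)⟩
    intro x hx
    have : x ≠ v := by simpa using hx
    simp [this, this.symm]
  · left
    simp [hv]

/-- For every integer `K ≥ 2`, the full influence `ν*_K` is not submodular: there exist a
finite simple undirected graph `G = (V,E)`, sets `S ⊆ T ⊆ V`, and a node `u ∈ V∖T` such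
that `ν*_K(u|S) < ν*_K(u|T)`, where `ν*_K(u|S) = ν*_K(S ∪ {u}) − ν*_K(S)`. -/
theorem stmt14 (K : ℕ) (hK : 2 ≤ K) :
    ∃ (n : ℕ) (G : SimpleGraph (Fin n)) (S T : Finset (Fin n)) (u : Fin n),
      S ⊆ T ∧ u ∉ T ∧
        nuStar G K (insert u S) - nuStar G K S
          < nuStar G K (insert u T) - nuStar G K T := by
  obtain ⟨m, rfl⟩ := Nat.exists_eq_add_of_le' hK
  have h01 : (1 : Fin (m + 3)) ≠ 0 := by simp
  have hc : ((univ : Finset (Fin (m + 3))).erase 0).card = m + 2 := by simp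
  have hm : (1 : Fin (m + 3)) ∈ (univ : Finset (Fin (m + 3))).erase 0 := by simp
  have hT : (((univ : Finset (Fin (m + 3))).erase 0).erase 1).card = m + 1 := by
    rw [card_erase_of_mem hm, hc]
    rfl
  refine ⟨m + 3, ⊤, ∅, (univ.erase 0).erase 1, 1, by simp, by simp, ?_⟩
  rw [nuStar_small _ _ ∅ (by simp), nuStar_small _ _ (insert 1 ∅) (by simp),
    nuStar_small _ _ ((univ.erase 0).erase 1) (by omega), insert_erase hm, hT]
  have hu : nuStar (⊤ : SimpleGraph (Fin (m + 3))) (m + 2) (univ.erase 0) = m + 3 := by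
    unfold nuStar
    rw [Fintype.card_fin, Function.iterate_succ_apply, ccStep_top _ _ hc.ge,
      Function.iterate_fixed (ccStep_univ _ _)]
    simp
  rw [hu]
  simp
  linarith
end

section
/- Let n, p, q, r be nonnegative integers with r ≤ q and p + q ≤ n − 1. Then Σ_{s=0}^{n−1} C(n−1−p−q, s−p−r) / C(n−1, s) = n / ((p+q+1) · C(p+q, p+r)), where C(x,y) = 0 if y > x or either argument is negative (terms with s < p + r contribute 0). -/
lemma add_choose_left (a b : ℕ) :
    (a + b).choose a * a.factorial * b.factorial = (a + b).factorial := by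
  have := Nat.choose_mul_factorial_mul_factorial (Nat.le_add_right a b)
  rwa [Nat.add_sub_cancel_left] at this

lemma pascal_sum (k : ℕ) (f : ℕ → ℝ) :
    ∑ j ∈ Finset.range (k + 2), ((k + 1).choose j : ℝ) * f j
      = ∑ j ∈ Finset.range (k + 1), (k.choose j : ℝ) * f j
        + ∑ j ∈ Finset.range (k + 1), (k.choose j : ℝ) * f (j + 1) := by
  have h1 : ∑ j ∈ Finset.range (k + 2), (k.choose j : ℝ) * f j
      = ∑ j ∈ Finset.range (k + 1), (k.choose j : ℝ) * f j := by
    rw [Finset.sum_range_succ]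
    simp
  rw [← h1, Finset.sum_range_succ', Finset.sum_range_succ' _ (k + 1)]
  simp only [Nat.choose_succ_succ, Nat.cast_add, add_mul, Finset.sum_add_distrib]
  simp
  ring

lemma inv_choose_step (a b : ℕ) :
    (((a + b + 1).choose a : ℝ))⁻¹ + (((a + b + 1).choose (a + 1) : ℝ))⁻¹
      = ((a : ℝ) + b + 2) / (((a : ℝ) + b + 1) * ((a + b).choose a : ℝ)) := by
  have e1 : (((a + (b + 1)).choose a : ℕ) : ℝ) * a.factorial * (b + 1).factorial
      = (a + b + 1).factorial := by
    exact_mod_cast add_choose_left a (b + 1)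
  have e2 : (((a + b + 1).choose (a + 1) : ℕ) : ℝ) * (a + 1).factorial * b.factorial
      = (a + b + 1).factorial := by
    have := add_choose_left (a + 1) b
    rw [show a + 1 + b = a + b + 1 by ring] at this
    exact_mod_cast this
  have e3 : (((a + b).choose a : ℕ) : ℝ) * a.factorial * b.factorial
      = (a + b).factorial := by
    exact_mod_cast add_choose_left a b
  rw [← add_assoc] at e1
  have p1 : (a.factorial : ℝ) ≠ 0 := by positivity
  have p2 : (b.factorial : ℝ) ≠ 0 := by positivity
  have p3 : ((a + b).factorial : ℝ) ≠ 0 := by positivity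
  have q1 : (a : ℝ) + 1 ≠ 0 := by positivity
  have q2 : (b : ℝ) + 1 ≠ 0 := by positivity
  have q3 : (a : ℝ) + b + 1 ≠ 0 := by positivity
  simp only [Nat.factorial_succ, Nat.cast_mul, Nat.cast_add, Nat.cast_one] at e1 e2
  have f1 : ((a + b + 1).choose a : ℝ)
      = ((a : ℝ) + b + 1) * (a + b).factorial / (a.factorial * ((b + 1) * b.factorial)) := by
    rw [eq_div_iff (by positivity)]; linarith
  have f2 : ((a + b + 1).choose (a + 1) : ℝ)
      = ((a : ℝ) + b + 1) * (a + b).factorial / (((a + 1) * a.factorial) * b.factorial) := by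
    rw [eq_div_iff (by positivity)]; linarith
  have f3 : ((a + b).choose a : ℝ)
      = ((a + b).factorial : ℝ) / (a.factorial * b.factorial) := by
    rw [eq_div_iff (by positivity)]; linarith
  rw [f1, f2, f3]
  field_simp
  ring

lemma key (k : ℕ) : ∀ a b : ℕ,
    ∑ j ∈ Finset.range (k + 1), (k.choose j : ℝ) * (((a + b + k).choose (a + j) : ℝ))⁻¹
      = ((a : ℝ) + b + k + 1) * ((((a : ℝ) + b + 1) * ((a + b).choose a : ℝ)))⁻¹ := by
  induction k with
  | zero =>
    intro a b
    have q3 : (a : ℝ) + b + 1 ≠ 0 := by positivity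
    simp
    field_simp
  | succ k ih =>
    intro a b
    rw [pascal_sum]
    have h1 := ih a (b + 1)
    have h2 := ih (a + 1) b
    rw [show a + (b + 1) + k = a + b + (k + 1) by ring] at h1
    rw [show a + 1 + b + k = a + b + (k + 1) by ring] at h2
    simp only [show ∀ j, a + 1 + j = a + (j + 1) from fun j => by ring] at h2
    rw [h1, h2, show a + (b + 1) = a + b + 1 by ring]
    have h3 := inv_choose_step a b
    have q3 : (a : ℝ) + b + 2 ≠ 0 := by positivity
    push_cast
    have : ((a : ℝ) + b + 1 + 1) = a + b + 2 := by ring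
    rw [show (a : ℝ) + (b + 1) + 1 = a + b + 2 by ring,
      show (a : ℝ) + 1 + b + 1 = a + b + 2 by ring, mul_inv, mul_inv]
    calc _ = ((a : ℝ) + b + (k + 1) + 1) * (a + b + 2 : ℝ)⁻¹ *
          ((((a + b + 1).choose a : ℝ))⁻¹ + (((a + b + 1).choose (a + 1) : ℝ))⁻¹) := by ring
      _ = _ := by
        rw [h3, div_eq_mul_inv]
        field_simp


/-- For nonnegative integers `n, p, q, r` with `r ≤ q` and `p + q ≤ n − 1`:
`Σ_{s=0}^{n−1} C(n−1−p−q, s−p−r) / C(n−1, s) = n / ((p+q+1) · C(p+q, p+r))`,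
where `C(x,y) = 0` if `y > x` or either argument is negative
(terms with `s < p + r` contribute `0`). -/
theorem stmt15 (n p q r : ℕ) (hr : r ≤ q) (hpq : p + q ≤ n - 1) :
    ∑ s ∈ Finset.range n,
        (chooseZ ((n : ℤ) - 1 - p - q) ((s : ℤ) - p - r) : ℝ) / ((n - 1).choose s : ℝ)
      = (n : ℝ) / (((p : ℝ) + q + 1) * ((p + q).choose (p + r) : ℝ)) := by
  rcases n with _ | m
  · obtain rfl : p = 0 := by omega
    obtain rfl : q = 0 := by omega
    simp
  obtain ⟨k, hk⟩ : ∃ k, m = p + q + k := ⟨m - (p + q), by omega⟩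
  obtain ⟨b, rfl⟩ := Nat.exists_eq_add_of_le hr
  have hkey := key k (p + r) b
  have hsub : ∑ s ∈ Finset.range (m + 1),
        (chooseZ (((m + 1 : ℕ) : ℤ) - 1 - p - (r + b : ℕ)) ((s : ℤ) - p - r) : ℝ)
          / ((m + 1 - 1).choose s : ℝ)
      = ∑ j ∈ Finset.range (k + 1),
        (k.choose j : ℝ) * (((p + r + b + k).choose (p + r + j) : ℝ))⁻¹ := by
    rw [show m + 1 = (p + r) + (b + k + 1) by omega, Finset.sum_range_add]
    rw [Finset.sum_eq_zero, zero_add]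
    · rw [show b + k + 1 = (k + 1) + b by omega, Finset.sum_range_add]
      rw [add_eq_left.mpr]
      · refine Finset.sum_congr rfl fun j _ => ?_
        rw [div_eq_mul_inv, show p + r + (k + 1 + b) - 1 = p + r + b + k by omega]
        congr 2
        have h1 : (((p + r + (k + 1 + b) : ℕ) : ℤ) - 1 - p - (r + b : ℕ)) = k := by
          push_cast; ring
        have h2 : (((p + r + j : ℕ) : ℤ) - p - r) = j := by push_cast; ring
        rw [h1, h2]
        simp [chooseZ]
      · refine Finset.sum_eq_zero fun j _ => ?_
        have h1 : (((p + r + (k + 1 + b) : ℕ) : ℤ) - 1 - p - (r + b : ℕ)) = k := by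
          push_cast; ring
        have h2 : (((p + r + (k + 1 + j) : ℕ) : ℤ) - p - r) = (k + 1 + j : ℕ) := by
          push_cast; ring
        have h3 : chooseZ (k : ℤ) ((k + 1 + j : ℕ) : ℤ) = 0 := by
          unfold chooseZ
          split_ifs
          · rfl
          · rw [Int.toNat_natCast, Int.toNat_natCast]
            exact Nat.choose_eq_zero_of_lt (by omega)
        rw [h1, h2, h3]
        simp
    · intro s hs
      rw [Finset.mem_range] at hs
      have : chooseZ (((p + r + (b + k + 1) : ℕ) : ℤ) - 1 - p - (r + b : ℕ))
          ((s : ℤ) - p - r) = 0 := by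
        unfold chooseZ
        rw [if_pos (Or.inr (by omega))]
      rw [this]
      simp
  rw [hsub, hkey, hk, div_eq_mul_inv, ← add_assoc p r b]
  push_cast
  congr 1 <;> ring
end

section
/- Let p, q, m be nonnegative integers with m ≤ q. Then Σ_{j=0}^{m} C(q, j) / C(p+q, p+j) = C(p+m+1, p+1) / C(p+q, p), where C(a,b) denotes the binomial coefficient. -/
/-- For nonnegative integers `p, q, m` with `m ≤ q`:
`Σ_{j=0}^{m} C(q, j) / C(p+q, p+j) = C(p+m+1, p+1) / C(p+q, p)`. -/
theorem stmt16 (p q m : ℕ) (hm : m ≤ q) :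
    ∑ j ∈ Finset.range (m + 1), (q.choose j : ℝ) / ((p + q).choose (p + j) : ℝ)
      = ((p + m + 1).choose (p + 1) : ℝ) / ((p + q).choose p : ℝ) := by
  have hs : ∑ j ∈ Finset.range (m + 1), (j + p).choose p = (p + m + 1).choose (p + 1) := by
    rw [Nat.sum_range_add_choose, Nat.add_comm m p]
  rw [← hs, Nat.cast_sum, Finset.sum_div]
  refine Finset.sum_congr rfl fun j hj => ?_
  have hj' : j ≤ q := by
    have := Finset.mem_range.mp hj
    omega
  have h1 : ((p + q).choose (p + j) : ℝ) ≠ 0 :=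
    Nat.cast_ne_zero.mpr (Nat.choose_pos (by omega)).ne'
  have h2 : ((p + q).choose p : ℝ) ≠ 0 :=
    Nat.cast_ne_zero.mpr (Nat.choose_pos (by omega)).ne'
  have h := Nat.choose_mul (n := p + q) (k := p + j) (s := p) (by omega)
  rw [Nat.add_sub_cancel_left, Nat.add_sub_cancel_left] at h
  have h' : ((p + q).choose (p + j) : ℝ) * ((p + j).choose p : ℝ)
      = ((p + q).choose p : ℝ) * (q.choose j : ℝ) := by exact_mod_cast h
  rw [div_eq_div_iff h1 h2, Nat.add_comm j p]
  linarith
end
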